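/- Let p ≥ 5 be a prime, k ≥ 2, and let χ be an even primitive Dirichlet character of conductor q = p^k. Let j be an integer with k/3 ≤ j ≤ k/2, and let ℓ be an integer with p ∤ ℓ such that χ(1 + p^j x) = e_{p^{k−j}}(ℓ (x − b p^j x²)) for all integers x, where b is an integer with 2b ≡ 1 (mod p^{k−j}). Let m be an integer with gcd(m, p) = 1, and let c be an integer with 2 ℓ c ≡ 1 (mod p^{k−2j}). Then Σ_{ψ mod p^j, ψ(−1)=1} τ(χ·ψ) · conj((χ·ψ)(m)) = q^{1/2} · φ(p^j) · Σ_{±} (1/2) e_{p^k}(± m) · [ℓ ≡ ∓ m (mod p^j)] · (−2ℓ | q) · ε_q · e_{p^{k−2j}}( c · ((ℓ ± m)/p^j)² ), where the outer sum runs over all even Dirichlet characters ψ modulo p^j, (· | q) is the Jacobi symbol, and [·] is 1 if the congruence holds and 0 otherwise. -/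

import Mathlib

open Complex

/-- `eN q x = e^{2πix/q}`. -/
noncomputable def eN (q : ℕ) (x : ℤ) : ℂ := Complex.exp (2 * Real.pi * Complex.I * x / q)

/-- `εq = 1` if `q ≡ 1 (mod 4)`, and `εq = i` if `q ≡ 3 (mod 4)`. -/
noncomputable def epsFactor (q : ℕ) : ℂ := if q % 4 = 1 then 1 else Complex.I

open Filter Topology in
lemma summable_exp_neg_pi_mul_sq {δ : ℂ} (hδ : 0 < δ.re) :
    Summable fun n : ℤ ↦ cexp (-Real.pi * δ * (n : ℂ) ^ 2) := by
  refine Summable.of_norm_bounded (summable_pow_mul_jacobiTheta₂_term_bound 0 hδ 0) fun n ↦ ?_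
  rw [Complex.norm_exp]
  have : (-(Real.pi : ℂ) * δ * (n : ℂ) ^ 2).re = -Real.pi * (δ.re * (n : ℝ) ^ 2 - 2 * 0 * |(n:ℝ)|) := by
    have : -(Real.pi : ℂ) * δ * (n : ℂ) ^ 2 = ((-Real.pi * (n : ℝ) ^ 2 : ℝ) : ℂ) * δ := by
      push_cast; ring
    rw [this, Complex.re_ofReal_mul]; ring
  rw [this]
  simp

lemma ofReal_mul_cpow {r : ℝ} (hr : 0 < r) {z : ℂ} (hz : z ≠ 0) (s : ℂ) :
    ((r : ℂ) * z) ^ s = (r : ℂ) ^ s * z ^ s := by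
  have hr' : (r : ℂ) ≠ 0 := by exact_mod_cast hr.ne'
  rw [cpow_def_of_ne_zero (mul_ne_zero hr' hz), cpow_def_of_ne_zero hr', cpow_def_of_ne_zero hz,
    log_ofReal_mul hr hz, ← Complex.exp_add, Complex.ofReal_log hr.le]
  ring_nf

open Filter Topology in
/-- The part of the theta series `∑ exp (-π δ n²)` in a residue class modulo `M`,
as `δ → 0` inside the right half plane. -/
lemma tendsto_cpow_half_mul_tsum_residue_class {ι : Type*} {l : Filter ι} {δ : ι → ℂ}
    (hpos : ∀ᶠ i in l, 0 < (δ i).re) (hδ : Tendsto (fun i ↦ ((δ i)⁻¹).re) l atTop)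
    {M : ℕ} (hM : 0 < M) (r : ℕ) :
    Tendsto (fun i ↦ (δ i) ^ (1 / 2 : ℂ) *
      ∑' n : ℤ, cexp (-Real.pi * δ i * ((r : ℂ) + M * n) ^ 2)) l (𝓝 (1 / M)) := by
  have hMr : (0 : ℝ) < M := by exact_mod_cast hM
  have hMc : (M : ℂ) ≠ 0 := by exact_mod_cast hM.ne'
  have key : ∀ i, 0 < (δ i).re → (δ i) ^ (1 / 2 : ℂ) *
      ∑' n : ℤ, cexp (-Real.pi * δ i * ((r : ℂ) + M * n) ^ 2) =
      1 / M * ∑' n : ℤ, cexp (-Real.pi * ((M : ℂ) ^ 2 * δ i)⁻¹ * n ^ 2 +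
        2 * Real.pi * (-I * r / M) * n) := by
    intro i hi
    have hne : δ i ≠ 0 := fun h ↦ by simp [h] at hi
    have hre : 0 < (((M : ℂ) ^ 2 * δ i)⁻¹).re := by
      rw [show ((M : ℂ) ^ 2 * δ i)⁻¹ = ((((M : ℝ) ^ 2)⁻¹ : ℝ) : ℂ) * (δ i)⁻¹ by
        push_cast; rw [mul_inv], re_ofReal_mul, Complex.inv_re]
      have := normSq_pos.mpr hne
      positivity
    rw [Complex.tsum_exp_neg_quadratic hre]
    have harg : ((M : ℂ) ^ 2 * δ i).arg ≠ Real.pi := by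
      have h2 : 0 < ((M : ℂ) ^ 2 * δ i).re := by
        rw [show (M : ℂ) ^ 2 * δ i = (((M : ℝ) ^ 2 : ℝ) : ℂ) * δ i by push_cast; rfl,
          re_ofReal_mul]
        positivity
      intro h
      rw [arg_eq_pi_iff] at h
      linarith [h.1]
    have hsq : ((M : ℂ) ^ 2 * δ i) ^ (1 / 2 : ℂ) = M * (δ i) ^ (1 / 2 : ℂ) := by
      rw [show (M : ℂ) ^ 2 = (((M : ℝ) ^ 2 : ℝ) : ℂ) by push_cast; rfl,
        ofReal_mul_cpow (by positivity) hne]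
      congr 1
      rw [show (1 / 2 : ℂ) = 2⁻¹ by norm_num]
      push_cast
      exact sq_cpow_two_inv (by simpa using hMr)
    rw [inv_cpow _ _ harg, hsq, one_div (_)⁻¹, inv_inv, ← mul_assoc, ← mul_assoc,
      one_div_mul_cancel hMc, one_mul]
    congr 1
    refine tsum_congr fun n ↦ ?_
    congr 1
    field_simp
    rw [I_sq]
    ring
  have hlim : Tendsto (fun i ↦ ∑' n : ℤ, cexp (-Real.pi * ((M : ℂ) ^ 2 * δ i)⁻¹ * n ^ 2 +
        2 * Real.pi * (-I * r / M) * n)) l (𝓝 (∑' n : ℤ, if n = 0 then 1 else 0)) := by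
    have hnorm : ∀ i (n : ℤ), ‖cexp (-Real.pi * ((M : ℂ) ^ 2 * δ i)⁻¹ * n ^ 2 +
        2 * Real.pi * (-I * r / M) * n)‖ =
        Real.exp (-(Real.pi * ((M : ℝ) ^ 2)⁻¹ * n ^ 2) * ((δ i)⁻¹).re) := by
      intro i n
      rw [norm_exp]
      congr 1
      rw [show -(Real.pi : ℂ) * ((M : ℂ) ^ 2 * δ i)⁻¹ * n ^ 2 + 2 * Real.pi * (-I * r / M) * n =
        ((-(Real.pi * ((M : ℝ) ^ 2)⁻¹ * n ^ 2) : ℝ) : ℂ) * (δ i)⁻¹ +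
          ((-2 * Real.pi * r / M * n : ℝ) : ℂ) * I by push_cast; rw [mul_inv]; ring,
        add_re, re_ofReal_mul, re_ofReal_mul, I_re, mul_zero, add_zero]
    refine tendsto_tsum_of_dominated_convergence
      (bound := fun n : ℤ ↦ ((|n| ^ 0 : ℤ) : ℝ) * Real.exp (-Real.pi * (1 * n ^ 2 - 2 * 0 * |(n : ℝ)|)))
      (by simpa using summable_pow_mul_jacobiTheta₂_term_bound 0 one_pos 0) ?_ ?_
    · intro n
      rcases eq_or_ne n 0 with rfl | hn
      · simp only [Int.cast_zero, ne_eq, OfNat.ofNat_ne_zero, not_false_eq_true, zero_pow, mul_zero,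
          add_zero, Complex.exp_zero, if_true]
        exact tendsto_const_nhds
      · rw [if_neg hn, tendsto_zero_iff_norm_tendsto_zero]
        simp_rw [hnorm]
        refine Real.tendsto_exp_atBot.comp (hδ.const_mul_atTop_of_neg ?_)
        have : (0 : ℝ) < (n : ℝ) ^ 2 := by positivity
        rw [neg_lt_zero]
        positivity
    · filter_upwards [hδ.eventually_ge_atTop ((M : ℝ) ^ 2)] with i hi n
      rw [hnorm]
      simp only [pow_zero, Int.cast_one, one_mul, mul_zero, zero_mul, sub_zero]
      refine Real.exp_le_exp.mpr ?_
      have h1 : 1 ≤ ((M : ℝ) ^ 2)⁻¹ * ((δ i)⁻¹).re := by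
        rw [inv_mul_eq_div, le_div_iff₀ (by positivity)]; linarith
      have h2 : 0 ≤ Real.pi * (n : ℝ) ^ 2 := by positivity
      nlinarith [mul_le_mul_of_nonneg_left h1 h2]
  rw [tsum_ite_eq] at hlim
  have := hlim.const_mul (1 / (M : ℂ))
  rw [mul_one] at this
  refine this.congr' ?_
  filter_upwards [hpos] with i hi using (key i hi).symm

open Filter Topology in
lemma tendsto_cpow_half_mul_tsum_periodic {ι : Type*} {l : Filter ι} {δ : ι → ℂ}
    (hpos : ∀ᶠ i in l, 0 < (δ i).re) (hδ : Tendsto (fun i ↦ ((δ i)⁻¹).re) l atTop)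
    {M : ℕ} (hM : 0 < M) {c : ℤ → ℂ} (hc : ∀ r n : ℤ, c (r + M * n) = c r) :
    Tendsto (fun i ↦ (δ i) ^ (1 / 2 : ℂ) *
      ∑' n : ℤ, c n * cexp (-Real.pi * δ i * (n : ℂ) ^ 2)) l
      (𝓝 (1 / M * ∑ r ∈ Finset.range M, c r)) := by
  have hM0 : (M : ℤ) ≠ 0 := by exact_mod_cast hM.ne'
  have key : ∀ i, 0 < (δ i).re → ∑' n : ℤ, c n * cexp (-Real.pi * δ i * (n : ℂ) ^ 2) =
      ∑ r ∈ Finset.range M, c r *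
        ∑' n : ℤ, cexp (-Real.pi * δ i * ((r : ℂ) + M * n) ^ 2) := by
    intro i hi
    have h1 : ∀ n : ℤ, c n * cexp (-Real.pi * δ i * (n : ℂ) ^ 2) = ∑ r ∈ Finset.range M,
        c r * Set.indicator (Set.range fun k : ℤ ↦ (r : ℤ) + M * k)
          (fun n : ℤ ↦ cexp (-Real.pi * δ i * (n : ℂ) ^ 2)) n := by
      intro n
      have hnn : ((n % M).toNat : ℤ) = n % M := Int.toNat_of_nonneg (Int.emod_nonneg _ hM0)
      have hlt : n % M < M := Int.emod_lt_of_pos _ (by exact_mod_cast hM)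
      rw [Finset.sum_eq_single (n % M).toNat]
      · rw [Set.indicator_of_mem]
        · rw [hnn]
          congr 1
          conv_lhs => rw [← Int.emod_add_mul_ediv n M]
          exact hc _ _
        · exact ⟨n / M, by simp only [hnn]; exact Int.emod_add_mul_ediv n M⟩
      · intro r hr hne
        rw [Set.indicator_of_notMem, mul_zero]
        rintro ⟨k, rfl⟩
        apply hne
        simp only [Int.add_mul_emod_self_left]
        rw [Int.emod_eq_of_lt (by positivity) (by exact_mod_cast Finset.mem_range.mp hr)]
        simp
      · intro h
        exact absurd (Finset.mem_range.mpr (by omega)) h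
    simp_rw [h1]
    rw [Summable.tsum_finsetSum fun r _ ↦
      ((summable_exp_neg_pi_mul_sq hi).indicator _).mul_left _]
    refine Finset.sum_congr rfl fun r _ ↦ ?_
    rw [tsum_mul_left]
    congr 1
    have hinj : Function.Injective fun k : ℤ ↦ (r : ℤ) + M * k := by
      intro a b hab
      simpa [hM.ne'] using hab
    rw [← hinj.tsum_eq (Set.support_indicator_subset)]
    refine tsum_congr fun k ↦ ?_
    rw [Set.indicator_of_mem (Set.mem_range_self k)]
    push_cast
    rfl
  have h2 : Tendsto (fun i ↦ ∑ r ∈ Finset.range M, c r * ((δ i) ^ (1 / 2 : ℂ) *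
        ∑' n : ℤ, cexp (-Real.pi * δ i * ((r : ℂ) + M * n) ^ 2))) l
      (𝓝 (∑ r ∈ Finset.range M, c r * (1 / M))) :=
    tendsto_finsetSum _ fun r _ ↦
      (tendsto_cpow_half_mul_tsum_residue_class hpos hδ hM r).const_mul _
  rw [← Finset.sum_mul, mul_comm] at h2
  refine h2.congr' ?_
  filter_upwards [hpos] with i hi
  rw [key i hi, Finset.mul_sum]
  exact Finset.sum_congr rfl fun r _ ↦ by ring

open Filter Topology in
/-- Gauss's evaluation of the quadratic Gauss sum, including its sign. -/
theorem sum_exp_sq_div (N : ℕ) (hN : 0 < N) :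
    ∑ r ∈ Finset.range N, cexp (2 * Real.pi * I * (r : ℂ) ^ 2 / N) =
      Real.sqrt N * ((1 + I) * (1 + (-I) ^ N) / 2) := by
  have hNr : (0 : ℝ) < N := by exact_mod_cast hN
  have hNc : (N : ℂ) ≠ 0 := by exact_mod_cast hN.ne'
  set κ : ℝ → ℂ := fun ε ↦ (N : ℂ) ^ 2 / (2 * (2 + I * N * ε)) with hκ
  set a : ℝ → ℂ := fun ε ↦ ε - 2 * I / N with ha
  have hd : ∀ ε : ℝ, (2 + I * N * ε : ℂ) ≠ 0 := fun ε h ↦ by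
    have := congrArg re h
    simp at this
  have hκne : ∀ ε, κ ε ≠ 0 := fun ε ↦
    div_ne_zero (pow_ne_zero _ hNc) (mul_ne_zero two_ne_zero (hd ε))
  have hre : ∀ ε : ℝ, (((ε : ℂ) * κ ε)⁻¹).re = 4 / (N : ℝ) ^ 2 * ε⁻¹ := by
    intro ε
    have : ((ε : ℂ) * κ ε)⁻¹ = ((4 / (N : ℝ) ^ 2 * ε⁻¹ : ℝ) : ℂ) +
        ((2 * N * ε / ((N : ℝ) ^ 2) * ε⁻¹ : ℝ) : ℂ) * I := by
      simp only [hκ, mul_inv, inv_div]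
      push_cast
      ring
    rw [this, add_re, re_ofReal_mul, ofReal_re, I_re]
    ring
  have hpos1 : ∀ᶠ ε : ℝ in 𝓝[>] 0, 0 < ((ε : ℂ)).re := by
    filter_upwards [self_mem_nhdsWithin] with ε hε
    simpa using hε
  have hpos2 : ∀ᶠ ε : ℝ in 𝓝[>] 0, 0 < ((ε : ℂ) * κ ε).re := by
    filter_upwards [self_mem_nhdsWithin] with ε (hε : 0 < ε)
    have h0 : 0 < (((ε : ℂ) * κ ε)⁻¹).re := by rw [hre]; positivity
    rw [inv_re] at h0
    by_contra h
    exact absurd h0 (not_lt.mpr (div_nonpos_of_nonpos_of_nonneg (not_lt.mp h) (normSq_nonneg _)))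
  have hlim1 : Tendsto (fun ε : ℝ ↦ ((ε : ℂ)⁻¹).re) (𝓝[>] 0) atTop := by
    refine tendsto_inv_nhdsGT_zero.congr fun ε ↦ ?_
    rw [← ofReal_inv, ofReal_re]
  have hlim2 : Tendsto (fun ε : ℝ ↦ (((ε : ℂ) * κ ε)⁻¹).re) (𝓝[>] 0) atTop := by
    simp_rw [hre]
    exact tendsto_inv_nhdsGT_zero.const_mul_atTop (by positivity)
  have T1 := tendsto_cpow_half_mul_tsum_periodic hpos1 hlim1 hN
    (c := fun n ↦ cexp (2 * Real.pi * I * (n : ℂ) ^ 2 / N)) (by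
      intro r n
      rw [Complex.exp_eq_exp_iff_exists_int]
      refine ⟨2 * r * n + N * n ^ 2, ?_⟩
      push_cast
      field_simp
      ring)
  have T2 := tendsto_cpow_half_mul_tsum_periodic hpos2 hlim2 (M := 2) (by norm_num)
    (c := fun n ↦ cexp (-Real.pi * I * N / 2 * (n : ℂ) ^ 2)) (by
      intro r n
      rw [Complex.exp_eq_exp_iff_exists_int]
      refine ⟨- (N * (r * n + n ^ 2)), ?_⟩
      push_cast
      ring)
  have ha0 : a 0 = ((1 - I) / (Real.sqrt N : ℂ)) ^ 2 := by
    have : ((Real.sqrt N : ℝ) : ℂ) ^ 2 = N := by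
      rw [← ofReal_pow, Real.sq_sqrt hNr.le]; simp
    rw [div_pow, this]
    simp only [ha, ofReal_zero]
    have : (1 - I) ^ 2 = -2 * I := by ring_nf; rw [I_sq]; ring
    rw [this]; ring
  have hκ0 : κ 0 = ((N : ℂ) / 2) ^ 2 := by
    simp only [hκ, ofReal_zero]; ring
  have hsa : a 0 ∈ slitPlane := by
    refine Or.inr ?_
    have : a 0 = ((-2 / N : ℝ) : ℂ) * I := by simp only [ha]; push_cast; ring
    rw [this, im_ofReal_mul, I_im, mul_one]
    exact (div_neg_of_neg_of_pos (by norm_num) hNr).ne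
  have hsκ : κ 0 ∈ slitPlane := by
    refine Or.inl ?_
    rw [hκ0, show ((N : ℂ) / 2) ^ 2 = (((N : ℝ) / 2) ^ 2 : ℝ) by push_cast; rfl, ofReal_re]
    positivity
  have Ta : Tendsto (fun ε ↦ a ε ^ (1 / 2 : ℂ)) (𝓝[>] 0) (𝓝 ((1 - I) / (Real.sqrt N : ℂ))) := by
    have hc : ContinuousAt (fun ε ↦ a ε ^ (1 / 2 : ℂ)) 0 :=
      ContinuousAt.cpow (by fun_prop) continuousAt_const hsa
    have := hc.tendsto.mono_left (nhdsWithin_le_nhds (s := Set.Ioi 0))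
    have hsq : (((1 - I) / (Real.sqrt N : ℂ)) ^ 2) ^ (1 / 2 : ℂ) = (1 - I) / (Real.sqrt N : ℂ) := by
      rw [one_div]
      refine sq_cpow_two_inv ?_
      rw [show (1 - I) / (Real.sqrt N : ℂ) = (((Real.sqrt N)⁻¹ : ℝ) : ℂ) * (1 - I) by
        push_cast; ring, re_ofReal_mul]
      have := Real.sqrt_pos.mpr hNr
      simp [hN]
    rwa [ha0, hsq] at this
  have Tκ : Tendsto (fun ε ↦ κ ε ^ (1 / 2 : ℂ)) (𝓝[>] 0) (𝓝 ((N : ℂ) / 2)) := by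
    have hc : ContinuousAt (fun ε ↦ κ ε ^ (1 / 2 : ℂ)) 0 := by
      refine ContinuousAt.cpow ?_ continuousAt_const hsκ
      simp only [hκ]
      refine ContinuousAt.div (by fun_prop) (by fun_prop) ?_
      exact mul_ne_zero two_ne_zero (hd 0)
    have := hc.tendsto.mono_left (nhdsWithin_le_nhds (s := Set.Ioi 0))
    have hsq : (((N : ℂ) / 2) ^ 2) ^ (1 / 2 : ℂ) = (N : ℂ) / 2 := by
      rw [one_div]
      refine sq_cpow_two_inv ?_
      rw [show (N : ℂ) / 2 = ((N / 2 : ℝ) : ℂ) by push_cast; rfl, ofReal_re]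
      positivity
    rwa [hκ0, hsq] at this
  have T3 := (T1.mul Ta).mul Tκ
  have heq : ∀ ε : ℝ, 0 < ε →
      ((ε : ℂ) ^ (1 / 2 : ℂ) * ∑' n : ℤ, cexp (2 * Real.pi * I * (n : ℂ) ^ 2 / N) *
        cexp (-Real.pi * ε * (n : ℂ) ^ 2)) * a ε ^ (1 / 2 : ℂ) * κ ε ^ (1 / 2 : ℂ) =
      ((ε : ℂ) * κ ε) ^ (1 / 2 : ℂ) * ∑' n : ℤ, cexp (-Real.pi * I * N / 2 * (n : ℂ) ^ 2) *
        cexp (-Real.pi * (ε * κ ε) * (n : ℂ) ^ 2) := by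
    intro ε hε
    have hare : (a ε).re = ε := by
      have : a ε = (ε : ℂ) + ((-2 / N : ℝ) : ℂ) * I := by simp only [ha]; push_cast; ring
      rw [this, add_re, re_ofReal_mul, ofReal_re, I_re]; ring
    have hane : a ε ≠ 0 := fun h ↦ by rw [h, zero_re] at hare; exact hε.ne hare
    have h1 := Complex.tsum_exp_neg_mul_int_sq (a := a ε) (by rw [hare]; exact hε)
    have h2 : ∀ n : ℤ, cexp (2 * Real.pi * I * (n : ℂ) ^ 2 / N) *
        cexp (-Real.pi * ε * (n : ℂ) ^ 2) = cexp (-Real.pi * a ε * (n : ℂ) ^ 2) := by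
      intro n
      rw [← Complex.exp_add]
      congr 1
      simp only [ha]
      ring
    have hinv : (a ε)⁻¹ = ε * κ ε + I * N / 2 := by
      refine inv_eq_of_mul_eq_one_left ?_
      have h4 : κ ε * (2 + I * N * ε) = (N : ℂ) ^ 2 / 2 := by
        simp only [hκ]
        rw [div_mul_eq_mul_div, div_eq_div_iff (mul_ne_zero two_ne_zero (hd ε)) two_ne_zero]
        ring
      have h5 : a ε = -I * (2 + I * N * ε) / N := by
        rw [eq_div_iff hNc]
        simp only [ha]
        rw [sub_mul, div_mul_cancel₀ _ hNc]
        linear_combination (N : ℂ) * ε * I_sq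
      rw [h5, mul_div_assoc', div_eq_one_iff_eq hNc]
      linear_combination -(I * ε) * h4 - (N : ℂ) * (2 + I * N * ε) / 2 * I_sq
    have h3 : ∀ n : ℤ, cexp (-Real.pi * I * N / 2 * (n : ℂ) ^ 2) *
        cexp (-Real.pi * (ε * κ ε) * (n : ℂ) ^ 2) = cexp (-Real.pi / a ε * (n : ℂ) ^ 2) := by
      intro n
      rw [← Complex.exp_add, div_eq_mul_inv _ (a ε), hinv]
      congr 1
      ring
    simp_rw [h2, h3]
    rw [h1, ofReal_mul_cpow hε (hκne ε)]
    have : a ε ^ (1 / 2 : ℂ) ≠ 0 := by simp [cpow_eq_zero_iff, hane]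
    field_simp
  have hfin := tendsto_nhds_unique (T3.congr' (by
    filter_upwards [self_mem_nhdsWithin] with ε hε using heq ε hε)) T2
  have hs : (Real.sqrt N : ℂ) ≠ 0 := by
    exact_mod_cast (Real.sqrt_pos.mpr hNr).ne'
  have hI : (1 - I : ℂ) ≠ 0 := fun h ↦ by simpa using congrArg re h
  have hpow : cexp (-Real.pi * I * N / 2) = (-I) ^ N := by
    rw [show -(Real.pi : ℂ) * I * N / 2 = N * (-Real.pi / 2 * I) by ring, Complex.exp_nat_mul,
      exp_neg_pi_div_two_mul_I]
  simp only [Finset.sum_range_succ, Finset.sum_range_zero, Nat.cast_zero,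
    Nat.cast_one, Int.cast_natCast, one_pow, mul_one, Nat.cast_ofNat, zero_add,
    ne_eq, OfNat.ofNat_ne_zero, not_false_eq_true, zero_pow, mul_zero, Complex.exp_zero, hpow]
    at hfin
  field_simp at hfin
  have h11 : (1 - I) * (1 + I) = 2 := by ring_nf; rw [I_sq]; ring
  refine mul_left_cancel₀ hI ?_
  linear_combination hfin - (Real.sqrt N : ℂ) * (1 + (-I) ^ N) / 2 * h11

lemma eN_add (q : ℕ) (x y : ℤ) : eN q (x + y) = eN q x * eN q y := by
  rw [eN, eN, eN, ← Complex.exp_add]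
  congr 1
  push_cast
  ring

lemma eN_eq_stdAddChar (q : ℕ) [NeZero q] (x : ℤ) : eN q x = ZMod.stdAddChar (x : ZMod q) := by
  rw [ZMod.stdAddChar_coe, eN]

lemma eN_congr {q : ℕ} (hq : q ≠ 0) {x y : ℤ} (h : x ≡ y [ZMOD q]) : eN q x = eN q y := by
  have : NeZero q := ⟨hq⟩
  rw [eN_eq_stdAddChar, eN_eq_stdAddChar, (ZMod.intCast_eq_intCast_iff _ _ _).mpr h]

lemma eN_mul_left {d : ℕ} (hd : d ≠ 0) (q : ℕ) (x : ℤ) : eN (d * q) (d * x) = eN q x := by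
  have : (d : ℂ) ≠ 0 := by exact_mod_cast hd
  rw [eN, eN]
  congr 1
  push_cast
  rw [show 2 * (Real.pi : ℂ) * I * (d * x) = d * (2 * Real.pi * I * x) by ring,
    mul_div_mul_left _ _ this]

lemma sum_eN_mul {M : ℕ} (hM : M ≠ 0) (u : ℤ) :
    ∑ x ∈ Finset.range M, eN M (u * x) = if (M : ℤ) ∣ u then (M : ℂ) else 0 := by
  have hMc : (M : ℂ) ≠ 0 := by exact_mod_cast hM
  have hpow : ∀ x : ℕ, eN M (u * x) = eN M u ^ x := by
    intro x
    rw [eN, eN, ← Complex.exp_nat_mul]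
    congr 1
    push_cast
    ring
  split_ifs with h
  · have h1 : eN M u = 1 := by
      rw [eN_congr hM (Int.modEq_zero_iff_dvd.mpr h)]
      simp [eN]
    simp [hpow, h1]
  · have hne : eN M u ≠ 1 := by
      rw [eN, Ne, Complex.exp_eq_one_iff]
      rintro ⟨n, hn⟩
      apply h
      refine ⟨n, ?_⟩
      rw [div_eq_iff hMc] at hn
      have : (u : ℂ) = M * n :=
        mul_left_cancel₀ Complex.two_pi_I_ne_zero (by linear_combination hn)
      exact_mod_cast this
    have h1 : eN M u ^ M = 1 := by
      rw [← hpow, eN_congr hM (Int.modEq_zero_iff_dvd.mpr (Dvd.intro_left u rfl))]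
      simp [eN]
    simp_rw [hpow]
    rw [geom_sum_eq hne, h1, sub_self, zero_div]

lemma sum_range_mul_eq {α : Type*} [AddCommMonoid α] (f : ℕ → α) (A B : ℕ) :
    ∑ i ∈ Finset.range (A * B), f i =
      ∑ r ∈ Finset.range A, ∑ x ∈ Finset.range B, f (r + A * x) := by
  induction B with
  | zero => simp
  | succ B ih =>
    rw [Nat.mul_succ, Finset.sum_range_add, ih]
    simp_rw [Finset.sum_range_succ, Finset.sum_add_distrib, add_comm (A * B)]

lemma sum_zmod_eq_sum_range {α : Type*} [AddCommMonoid α] (q : ℕ) [NeZero q] (F : ZMod q → α) :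
    ∑ t : ZMod q, F t = ∑ i ∈ Finset.range q, F i := by
  refine Finset.sum_bij' (fun t _ ↦ t.val) (fun i _ ↦ (i : ZMod q)) ?_ ?_ ?_ ?_ ?_
  · intro t _; exact Finset.mem_range.mpr t.val_lt
  · intros; exact Finset.mem_univ _
  · intro t _; exact ZMod.natCast_zmod_val t
  · intro i hi; exact ZMod.val_cast_of_lt (Finset.mem_range.mp hi)
  · intro t _; rw [ZMod.natCast_zmod_val]

/-- A sum of a quadratic phase whose leading coefficient is divisible by `P`. -/
lemma sum_eN_quadratic_mul {P Q : ℕ} (hP : P ≠ 0) (hQ : Q ≠ 0) (A B : ℤ) :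
    ∑ x ∈ Finset.range (Q * P), eN (P * Q) (A * x + B * P * x ^ 2) =
      if (P : ℤ) ∣ A then (P : ℂ) * ∑ y ∈ Finset.range Q, eN Q (A / P * y + B * y ^ 2) else 0 := by
  have hPQ : P * Q ≠ 0 := mul_ne_zero hP hQ
  have h1 : ∀ y x : ℕ, eN (P * Q) (A * (y + Q * x : ℕ) + B * P * (y + Q * x : ℕ) ^ 2) =
      eN (P * Q) (A * y + B * P * y ^ 2) * eN P (A * x) := by
    intro y x
    rw [← eN_mul_left hQ P (A * x), mul_comm Q P, ← eN_add]
    refine eN_congr hPQ (Int.modEq_iff_dvd.mpr ⟨-(B * (2 * y * x + Q * x ^ 2)), ?_⟩)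
    push_cast
    ring
  rw [sum_range_mul_eq]
  simp_rw [h1, ← Finset.mul_sum, sum_eN_mul hP]
  split_ifs with h
  · obtain ⟨a, rfl⟩ := h
    have hPZ : (P : ℤ) ≠ 0 := by exact_mod_cast hP
    rw [Int.mul_ediv_cancel_left _ hPZ, ← Finset.sum_mul, mul_comm]
    congr 1
    refine Finset.sum_congr rfl fun y _ ↦ ?_
    rw [← eN_mul_left hP Q (a * y + B * y ^ 2)]
    congr 1
    ring
  · simp

open ZMod in
lemma sum_stdAddChar_mul_sq {p : ℕ} [Fact p.Prime] (hp : p ≠ 2) {a : ZMod p} (ha : a ≠ 0) :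
    ∑ x : ZMod p, stdAddChar (a * x ^ 2) =
      (quadraticChar (ZMod p) a : ℂ) * ∑ x : ZMod p, stdAddChar (x ^ 2) := by
  have hchar : ringChar (ZMod p) ≠ 2 := by rwa [ZMod.ringChar_zmod_n]
  set χ := (quadraticChar (ZMod p)).ringHomComp (Int.castRingHom ℂ) with hχ
  have hfib : ∀ b : ZMod p, b ≠ 0 → ∑ x : ZMod p, stdAddChar (b * x ^ 2) =
      gaussSum χ (stdAddChar.mulShift b) := by
    intro b hb
    have h0 : ∑ y : ZMod p, stdAddChar (b * y) = (0 : ℂ) := by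
      have := AddChar.sum_mulShift b (ZMod.isPrimitive_stdAddChar p)
      simp_rw [mul_comm b, this, if_neg hb]
      simp
    rw [← Finset.sum_fiberwise (s := Finset.univ) (g := fun x : ZMod p ↦ x ^ 2)]
    have h1 : ∀ y : ZMod p, ∑ x : ZMod p with x ^ 2 = y, stdAddChar (b * x ^ 2) =
        χ y * stdAddChar (b * y) + stdAddChar (b * y) := by
      intro y
      rw [Finset.sum_congr rfl (g := fun _ ↦ stdAddChar (b * y))
        (fun x hx ↦ by rw [(Finset.mem_filter.mp hx).2]), Finset.sum_const, nsmul_eq_mul,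
        ← add_one_mul]
      congr 1
      have := quadraticChar_card_sqrts hchar y
      simp only [Set.toFinset_ofPred] at this
      have h2 := congrArg (Int.cast : ℤ → ℂ) this
      push_cast at h2
      rw [h2, hχ]
      simp
    simp_rw [h1]
    rw [Finset.sum_add_distrib, h0, add_zero, gaussSum]
    simp [AddChar.mulShift_apply]
  have hone := hfib 1 one_ne_zero
  rw [AddChar.mulShift_one] at hone
  simp_rw [one_mul] at hone
  rw [hfib a ha, hone, ← gaussSum_mulShift χ stdAddChar (Units.mk0 a ha), ← mul_assoc]
  have : (quadraticChar (ZMod p) a : ℂ) * χ (Units.mk0 a ha) = 1 := by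
    have := quadraticChar_sq_one ha
    simp only [hχ, Units.val_mk0, MulChar.ringHomComp_apply, eq_intCast]
    rw [← sq]
    exact_mod_cast this
  rw [this, one_mul]
  rfl

lemma sqrt_mul_sign_factor_eq {N : ℕ} (hN : N % 2 = 1) :
    (1 + I) * (1 + (-I) ^ N) / 2 = epsFactor N := by
  have hI2 : (-I) ^ 4 = 1 := by
    rw [neg_pow, I_pow_four]; norm_num
  have hred : (-I) ^ N = (-I) ^ (N % 4) := by
    conv_lhs => rw [← Nat.mod_add_div N 4, pow_add, pow_mul, hI2, one_pow, mul_one]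
  rw [hred, epsFactor]
  rcases (show N % 4 = 1 ∨ N % 4 = 3 by omega) with h | h
  · rw [h, if_pos rfl, pow_one]
    linear_combination -(1 / 2 : ℂ) * I_sq
  · rw [h, if_neg (by norm_num)]
    rw [show (-I) ^ 3 = -(I * I ^ 2) by ring, I_sq]
    linear_combination (1 / 2 : ℂ) * I_sq

lemma sum_eN_mul_sq_prime {p : ℕ} (hp : p.Prime) (hp2 : p ≠ 2) {a : ℤ} (ha : ¬ (p : ℤ) ∣ a) :
    ∑ y ∈ Finset.range p, eN p (a * y ^ 2) =
      (jacobiSym a p : ℂ) * epsFactor p * Real.sqrt p := by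
  have := Fact.mk hp
  have ha' : (a : ZMod p) ≠ 0 := by rwa [Ne, ZMod.intCast_zmod_eq_zero_iff_dvd]
  have h1 : ∀ b : ℤ, ∑ y ∈ Finset.range p, eN p (b * y ^ 2) =
      ∑ x : ZMod p, ZMod.stdAddChar ((b : ZMod p) * x ^ 2) := by
    intro b
    rw [sum_zmod_eq_sum_range]
    refine Finset.sum_congr rfl fun y _ ↦ ?_
    rw [eN_eq_stdAddChar]
    push_cast
    rfl
  rw [h1, sum_stdAddChar_mul_sq hp2 ha', ← jacobiSym.legendreSym.to_jacobiSym, legendreSym]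
  have h2 := h1 1
  simp only [Int.cast_one, one_mul] at h2
  rw [← h2, mul_assoc]
  congr 1
  rw [← sqrt_mul_sign_factor_eq (hp.eq_two_or_odd.resolve_left hp2), mul_comm,
    ← sum_exp_sq_div p hp.pos]
  refine Finset.sum_congr rfl fun y _ ↦ ?_
  rw [eN]
  push_cast
  rfl

lemma sum_eN_mul_sq_pow_add_two {p : ℕ} (hp : p.Prime) (hp2 : p ≠ 2) {a : ℤ}
    (ha : ¬ (p : ℤ) ∣ a) (n : ℕ) :
    ∑ y ∈ Finset.range (p ^ (n + 2)), eN (p ^ (n + 2)) (a * y ^ 2) =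
      p * ∑ y ∈ Finset.range (p ^ n), eN (p ^ n) (a * y ^ 2) := by
  have hp0 : p ≠ 0 := hp.ne_zero
  have h1 : ∀ y x : ℕ, eN (p ^ (n + 2)) (a * (y + p ^ (n + 1) * x : ℕ) ^ 2) =
      eN (p ^ (n + 2)) (a * y ^ 2) * eN p (2 * a * y * x) := by
    intro y x
    rw [← eN_mul_left (pow_ne_zero (n + 1) hp0) p, ← pow_succ, ← eN_add]
    refine eN_congr (pow_ne_zero _ hp0) (Int.modEq_iff_dvd.mpr ⟨-(a * p ^ n * x ^ 2), ?_⟩)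
    push_cast
    ring
  have hdvd : ∀ y : ℕ, (p : ℤ) ∣ 2 * a * y ↔ p ∣ y := by
    intro y
    have hpZ : Prime (p : ℤ) := Nat.prime_iff_prime_int.mp hp
    rw [hpZ.dvd_mul, hpZ.dvd_mul, Int.natCast_dvd_natCast]
    have h2 : ¬ (p : ℤ) ∣ 2 := by
      intro h
      exact hp2 ((Nat.prime_dvd_prime_iff_eq hp Nat.prime_two).mp (by exact_mod_cast h))
    tauto
  conv_lhs => rw [show Finset.range (p ^ (n + 2)) = Finset.range (p ^ (n + 1) * p) by rw [← pow_succ]]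
  rw [sum_range_mul_eq]
  simp_rw [h1, ← Finset.mul_sum, sum_eN_mul hp0, hdvd]
  rw [show p ^ (n + 1) = p * p ^ n by ring, sum_range_mul_eq, Finset.sum_eq_single 0, Finset.mul_sum]
  · refine Finset.sum_congr rfl fun x _ ↦ ?_
    rw [zero_add, if_pos (Dvd.intro _ rfl), mul_comm, ← eN_mul_left (pow_ne_zero 2 hp0) (p ^ n)]
    congr 2
    · ring
    · push_cast; ring
  · intro r hr hr0
    refine Finset.sum_eq_zero fun x _ ↦ ?_
    rw [if_neg, mul_zero]
    rw [Nat.dvd_add_left (Dvd.intro _ rfl)]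
    exact fun h ↦ hr0 (Nat.eq_zero_of_dvd_of_lt h (Finset.mem_range.mp hr))
  · intro h
    exact absurd (Finset.mem_range.mpr hp.pos) h

lemma odd_sq_mul_mod_four {p N : ℕ} (hp : p % 2 = 1) : p ^ 2 * N % 4 = N % 4 := by
  have : p ^ 2 % 4 = 1 := by
    rw [Nat.pow_mod]
    rcases (show p % 4 = 1 ∨ p % 4 = 3 by omega) with h | h <;> rw [h]
  rw [Nat.mul_mod, this, one_mul, Nat.mod_mod]

lemma epsFactor_pow_add_two_mul {p : ℕ} (hp : p % 2 = 1) (n i : ℕ) :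
    epsFactor (p ^ (n + 2 * i)) = epsFactor (p ^ n) := by
  rw [epsFactor, epsFactor, show p ^ (n + 2 * i) = (p ^ i) ^ 2 * p ^ n by ring,
    odd_sq_mul_mod_four (by rw [Nat.pow_mod, hp]; simp)]

lemma jacobiSym_pow_add_two_mul {p : ℕ} (hp : p.Prime) {a : ℤ} (ha : ¬ (p : ℤ) ∣ a) (n i : ℕ) :
    jacobiSym a (p ^ (n + 2 * i)) = jacobiSym a (p ^ n) := by
  have hg : Int.gcd a p = 1 := by
    rw [Int.gcd_comm]
    exact Int.isCoprime_iff_gcd_eq_one.mp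
      ((Nat.prime_iff_prime_int.mp hp).irreducible.coprime_iff_not_dvd.mpr ha)
  rw [jacobiSym.pow_right, jacobiSym.pow_right, pow_add, pow_mul, jacobiSym.sq_one hg, one_pow,
    mul_one]

lemma sqrt_pow_add_two_mul (p n i : ℕ) :
    Real.sqrt (p ^ (n + 2 * i)) = p ^ i * Real.sqrt (p ^ n) := by
  rw [show (p : ℝ) ^ (n + 2 * i) = (p ^ i) ^ 2 * p ^ n by ring, Real.sqrt_mul (by positivity),
    Real.sqrt_sq (by positivity)]

/-- The quadratic Gauss sum modulo an odd prime power. -/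
theorem sum_eN_mul_sq_prime_pow {p : ℕ} (hp : p.Prime) (hp2 : p ≠ 2) {a : ℤ}
    (ha : ¬ (p : ℤ) ∣ a) (n : ℕ) :
    ∑ y ∈ Finset.range (p ^ n), eN (p ^ n) (a * y ^ 2) =
      (jacobiSym a (p ^ n) : ℂ) * epsFactor (p ^ n) * Real.sqrt (p ^ n) := by
  have hodd : p % 2 = 1 := hp.eq_two_or_odd.resolve_left hp2
  induction n using Nat.twoStepInduction with
  | zero => simp [eN, epsFactor]
  | one => simpa using sum_eN_mul_sq_prime hp hp2 ha
  | more n ih _ =>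
    rw [sum_eN_mul_sq_pow_add_two hp hp2 ha, ih]
    have h1 := epsFactor_pow_add_two_mul hodd n 1
    have h2 := jacobiSym_pow_add_two_mul hp ha n 1
    have h3 := sqrt_pow_add_two_mul p n 1
    rw [mul_one] at h1 h2 h3
    rw [h1, h2, h3]
    push_cast
    ring

lemma sum_eN_complete_square {q : ℕ} (hq : q ≠ 0) {ℓ b c : ℤ} (A : ℤ)
    (hb : 2 * b ≡ 1 [ZMOD q]) (hc : 2 * ℓ * c ≡ 1 [ZMOD q]) :
    ∑ y ∈ Finset.range q, eN q (A * y + -(b * ℓ) * y ^ 2) =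
      eN q (c * A ^ 2) * ∑ y ∈ Finset.range q, eN q (-(b * ℓ) * y ^ 2) := by
  have : NeZero q := ⟨hq⟩
  have hb' : (2 * (b : ZMod q)) = 1 := by exact_mod_cast (ZMod.intCast_eq_intCast_iff _ _ _).mpr hb
  have hc' : (2 * (ℓ : ZMod q) * (c : ZMod q)) = 1 := by
    exact_mod_cast (ZMod.intCast_eq_intCast_iff _ _ _).mpr hc
  have h1 : ∑ y ∈ Finset.range q, eN q (-(b * ℓ) * y ^ 2) =
      ∑ t : ZMod q, ZMod.stdAddChar (-((b : ZMod q) * (ℓ : ZMod q)) * t ^ 2) := by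
    rw [sum_zmod_eq_sum_range]
    refine Finset.sum_congr rfl fun y _ ↦ ?_
    rw [eN_eq_stdAddChar]
    push_cast
    rfl
  have h2 : ∑ y ∈ Finset.range q, eN q (A * y + -(b * ℓ) * y ^ 2) =
      ∑ t : ZMod q, ZMod.stdAddChar ((A : ZMod q) * t + -((b : ZMod q) * (ℓ : ZMod q)) * t ^ 2) := by
    rw [sum_zmod_eq_sum_range]
    refine Finset.sum_congr rfl fun y _ ↦ ?_
    rw [eN_eq_stdAddChar]
    push_cast
    rfl
  rw [h1, h2, ← Equiv.sum_comp (Equiv.addRight (2 * (c : ZMod q) * (A : ZMod q))), Finset.mul_sum]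
  refine Finset.sum_congr rfl fun t _ ↦ ?_
  rw [eN_eq_stdAddChar, ← AddChar.map_add_eq_mul]
  congr 1
  simp only [Equiv.coe_addRight]
  push_cast
  linear_combination -((A : ZMod q) * t + (c : ZMod q) * (A : ZMod q) ^ 2) *
    ((2 * (ℓ : ZMod q) * (c : ZMod q)) * hb' + hc')

lemma sum_ite_castHom_eq_one {p j k : ℕ} (hp : 2 ≤ p) (hj : j ≠ 0) (hjk : j ≤ k)
    [NeZero (p ^ k)] (F : ZMod (p ^ k) → ℂ) [DecidableEq (ZMod (p ^ j))] :
    ∑ s : ZMod (p ^ k),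
        (if ZMod.castHom (pow_dvd_pow p hjk) (ZMod (p ^ j)) s = 1 then F s else 0) =
      ∑ x ∈ Finset.range (p ^ (k - j)), F ((1 + p ^ j * x : ℤ) : ZMod (p ^ k)) := by
  have h1 : 1 < p ^ j := Nat.one_lt_pow hj hp
  rw [sum_zmod_eq_sum_range]
  conv_lhs => rw [show Finset.range (p ^ k) = Finset.range (p ^ j * p ^ (k - j)) by
    rw [← pow_add, Nat.add_sub_cancel' hjk]]
  rw [sum_range_mul_eq, Finset.sum_eq_single_of_mem 1 (Finset.mem_range.mpr h1)]
  · refine Finset.sum_congr rfl fun x _ ↦ ?_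
    have h0 : ((p : ZMod (p ^ j)) ^ j) = 0 := by exact_mod_cast ZMod.natCast_self (p ^ j)
    rw [if_pos]
    · push_cast
      rfl
    · rw [map_natCast]
      push_cast
      rw [h0, zero_mul, add_zero]
  · intro r hr hr1
    refine Finset.sum_eq_zero fun x _ ↦ if_neg fun h ↦ hr1 ?_
    have h0 : ((p : ZMod (p ^ j)) ^ j) = 0 := by exact_mod_cast ZMod.natCast_self (p ^ j)
    have h2 : (r : ZMod (p ^ j)) = (1 : ℕ) := by
      rw [map_natCast] at h
      push_cast at h ⊢
      rwa [h0, zero_mul, add_zero] at h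
    rw [ZMod.natCast_eq_natCast_iff'] at h2
    rwa [Nat.mod_eq_of_lt (Finset.mem_range.mp hr), Nat.mod_eq_of_lt h1] at h2

lemma changeLevel_pow_apply {p j k : ℕ} (hj : j ≠ 0) (hjk : j ≤ k)
    (ψ : DirichletCharacter ℂ (p ^ j)) (t : ZMod (p ^ k)) :
    DirichletCharacter.changeLevel (pow_dvd_pow p hjk) ψ t =
      ψ (ZMod.castHom (pow_dvd_pow p hjk) (ZMod (p ^ j)) t) := by
  have hk : k ≠ 0 := by omega
  obtain ⟨i, rfl⟩ := ZMod.intCast_surjective t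
  have hiff : IsUnit ((i : ℤ) : ZMod (p ^ k)) ↔ IsUnit ((i : ℤ) : ZMod (p ^ j)) := by
    rw [ZMod.coe_int_isUnit_iff_isCoprime, ZMod.coe_int_isUnit_iff_isCoprime]
    push_cast
    rw [IsCoprime.pow_left_iff (Nat.pos_of_ne_zero hk),
      IsCoprime.pow_left_iff (Nat.pos_of_ne_zero hj)]
  by_cases h : IsUnit ((i : ℤ) : ZMod (p ^ k))
  · obtain ⟨u, hu⟩ := h
    rw [← hu, DirichletCharacter.changeLevel_eq_cast_of_dvd]
    rfl
  · rw [MulChar.map_nonunit _ h, map_intCast, MulChar.map_nonunit _ (hiff.not.mp h)]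

open Classical in
lemma sum_even_char_mul_conj {N : ℕ} [NeZero N] {a : ZMod N} (ha : IsUnit a) (t : ZMod N) :
    ∑ ψ : DirichletCharacter ℂ N, (if ψ.Even then ψ t * (starRingEnd ℂ) (ψ a) else 0) =
      (N.totient : ℂ) / 2 * ((if t = a then 1 else 0) + (if t = -a then 1 else 0)) := by
  have hconj : ∀ ψ : DirichletCharacter ℂ N, (starRingEnd ℂ) (ψ a) = ψ a⁻¹ := by
    intro ψ
    obtain ⟨u, rfl⟩ := ha
    have h1 : ‖ψ u‖ = 1 := DirichletCharacter.unit_norm_eq_one ψ u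
    rw [← Complex.inv_eq_conj h1]
    refine inv_eq_of_mul_eq_one_right ?_
    rw [← map_mul, ZMod.mul_inv_of_unit _ u.isUnit, map_one]
  have h1 : ∀ ψ : DirichletCharacter ℂ N,
      (if ψ.Even then ψ t * (starRingEnd ℂ) (ψ a) else 0) =
        1 / 2 * (ψ a⁻¹ * ψ t) + 1 / 2 * (ψ a⁻¹ * ψ (-t)) := by
    intro ψ
    rw [hconj, ← neg_one_mul t, map_mul]
    rcases ψ.even_or_odd with h | h
    · rw [if_pos h, h]
      ring
    · rw [if_neg, h]
      · ring
      · intro h'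
        have := h.symm.trans h'
        norm_num at this
  simp_rw [h1]
  rw [Finset.sum_add_distrib, ← Finset.mul_sum, ← Finset.mul_sum,
    DirichletCharacter.sum_char_inv_mul_char_eq ℂ ha, DirichletCharacter.sum_char_inv_mul_char_eq ℂ ha]
  have e1 : a = t ↔ t = a := eq_comm
  have e2 : a = -t ↔ t = -a := by rw [eq_comm, neg_eq_iff_eq_neg]
  simp only [e1, e2]
  split_ifs <;> ring

lemma sum_eN_linear_add_quadratic {p j k : ℕ} (hp : p.Prime) (hp2 : p ≠ 2) (hjk : 2 * j ≤ k)
    {ℓ b c : ℤ} (hℓ : ¬ (p : ℤ) ∣ ℓ) (hb : 2 * b ≡ 1 [ZMOD (p ^ (k - j) : ℕ)])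
    (hc : 2 * ℓ * c ≡ 1 [ZMOD (p ^ (k - 2 * j) : ℕ)]) (hj : j ≠ 0) (A : ℤ) :
    ∑ x ∈ Finset.range (p ^ (k - j)), eN (p ^ (k - j)) (A * x + -(b * ℓ) * p ^ j * x ^ 2) =
      if (p ^ j : ℤ) ∣ A then
        eN (p ^ (k - 2 * j)) (c * (A / (p ^ j : ℤ)) ^ 2) *
          ((jacobiSym (-2 * ℓ) (p ^ k) : ℂ) * epsFactor (p ^ k) * Real.sqrt (p ^ k)) else 0 := by
  obtain ⟨n, rfl⟩ : ∃ n, k = n + 2 * j := ⟨k - 2 * j, by omega⟩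
  rw [show n + 2 * j - j = j + n by omega] at hb ⊢
  rw [Nat.add_sub_cancel] at hc ⊢
  have hpZ : Prime (p : ℤ) := Nat.prime_iff_prime_int.mp hp
  have hb1 : ¬ (p : ℤ) ∣ b := by
    intro h
    have h1 : (p : ℤ) ∣ 1 - 2 * b :=
      (Int.natCast_dvd_natCast.mpr (dvd_pow_self p (by omega))).trans hb.dvd
    exact hpZ.not_dvd_one (by simpa using dvd_add h1 (h.mul_left 2))
  have hbℓ : ¬ (p : ℤ) ∣ -(b * ℓ) := by
    rw [dvd_neg, hpZ.dvd_mul]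
    tauto
  have h2 : ¬ (p : ℤ) ∣ 2 := by
    intro h
    exact hp2 ((Nat.prime_dvd_prime_iff_eq hp Nat.prime_two).mp (by exact_mod_cast h))
  have hℓ2 : ¬ (p : ℤ) ∣ -2 * ℓ := by
    rw [neg_mul, dvd_neg, hpZ.dvd_mul]
    tauto
  have hb' : 2 * b ≡ 1 [ZMOD (p ^ n : ℕ)] :=
    hb.of_dvd (Int.natCast_dvd_natCast.mpr (pow_dvd_pow p (by omega)))
  have hJ : jacobiSym (-(b * ℓ)) (p ^ n) = jacobiSym (-2 * ℓ) (p ^ n) := by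
    have h4 : jacobiSym (2 ^ 2) (p ^ n) = 1 := by
      refine jacobiSym.sq_one' ?_
      rw [Int.gcd_comm]
      push_cast
      exact Int.isCoprime_iff_gcd_eq_one.mp
        ((hpZ.irreducible.coprime_iff_not_dvd.mpr h2).pow_left)
    have h5 : -2 * ℓ ≡ 2 ^ 2 * -(b * ℓ) [ZMOD (p ^ n : ℕ)] := by
      have := (hb'.mul_right (-2 * ℓ)).symm
      rw [one_mul] at this
      convert this using 1
      ring
    rw [jacobiSym.mod_left' h5, jacobiSym.mul_left, h4, one_mul]
  have key := sum_eN_quadratic_mul (P := p ^ j) (Q := p ^ n) (pow_ne_zero j hp.ne_zero)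
    (pow_ne_zero n hp.ne_zero) A (-(b * ℓ))
  rw [← pow_add, ← pow_add, add_comm n j] at key
  push_cast at key
  rw [key]
  split_ifs with h
  · rw [sum_eN_complete_square (pow_ne_zero n hp.ne_zero) _ hb' hc,
      sum_eN_mul_sq_prime_pow hp hp2 hbℓ, hJ, jacobiSym_pow_add_two_mul hp hℓ2,
      epsFactor_pow_add_two_mul (hp.eq_two_or_odd.resolve_left hp2), sqrt_pow_add_two_mul]
    push_cast
    ring
  · rfl

open Classical in
lemma sum_ite_castHom_eq_mul_conj {p j k : ℕ} (hp : p.Prime) (hp2 : p ≠ 2) (hjk : 2 * j ≤ k)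
    (hj : j ≠ 0) [NeZero (p ^ k)] (χ : DirichletCharacter ℂ (p ^ k))
    {ℓ b c : ℤ} (hℓ : ¬ (p : ℤ) ∣ ℓ) (hb : 2 * b ≡ 1 [ZMOD (p ^ (k - j) : ℕ)])
    (hpost : ∀ x : ℤ, χ ((1 + p ^ j * x : ℤ) : ZMod (p ^ k)) =
      eN (p ^ (k - j)) (ℓ * (x - b * p ^ j * x ^ 2)))
    (hc : 2 * ℓ * c ≡ 1 [ZMOD (p ^ (k - 2 * j) : ℕ)]) {u : ℤ} (hu : IsCoprime u (p : ℤ)) :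
    ∑ t : ZMod (p ^ k),
        (if ZMod.castHom (pow_dvd_pow p (by omega : j ≤ k)) (ZMod (p ^ j)) t = (u : ZMod (p ^ j))
          then χ t * eN (p ^ k) (t.val : ℤ) * (starRingEnd ℂ) (χ (u : ZMod (p ^ k))) else 0) =
      eN (p ^ k) u * (if ℓ ≡ -u [ZMOD (p ^ j : ℕ)] then 1 else 0) *
        (jacobiSym (-2 * ℓ) (p ^ k) : ℂ) * epsFactor (p ^ k) *
        eN (p ^ (k - 2 * j)) (c * ((ℓ + u) / (p ^ j : ℤ)) ^ 2) * Real.sqrt (p ^ k) := by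
  have huk : IsUnit ((u : ℤ) : ZMod (p ^ k)) := by
    rw [ZMod.coe_int_isUnit_iff_isCoprime]
    push_cast
    exact hu.symm.pow_left
  have huj : IsUnit ((u : ℤ) : ZMod (p ^ j)) := by
    rw [ZMod.coe_int_isUnit_iff_isCoprime]
    push_cast
    exact hu.symm.pow_left
  have hnorm : χ (u : ZMod (p ^ k)) * (starRingEnd ℂ) (χ (u : ZMod (p ^ k))) = 1 := by
    obtain ⟨v, hv⟩ := huk
    rw [← hv, Complex.mul_conj, Complex.normSq_eq_norm_sq, DirichletCharacter.unit_norm_eq_one]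
    simp
  rw [← Equiv.sum_comp huk.unit.mulLeft]
  have hsub : ∀ s : ZMod (p ^ k),
      (if ZMod.castHom (pow_dvd_pow p (by omega : j ≤ k)) (ZMod (p ^ j)) (huk.unit.mulLeft s) =
          (u : ZMod (p ^ j))
        then χ (huk.unit.mulLeft s) * eN (p ^ k) ((huk.unit.mulLeft s).val : ℤ) *
          (starRingEnd ℂ) (χ (u : ZMod (p ^ k))) else 0) =
      if ZMod.castHom (pow_dvd_pow p (by omega : j ≤ k)) (ZMod (p ^ j)) s = 1
        then χ s * ZMod.stdAddChar ((u : ZMod (p ^ k)) * s) else 0 := by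
    intro s
    simp only [Units.mulLeft_apply, IsUnit.unit_spec]
    refine ite_congr (propext ?_) (fun _ ↦ ?_) (fun _ ↦ rfl)
    · rw [map_mul, map_intCast]
      nth_rewrite 2 [← mul_one (u : ZMod (p ^ j))]
      exact huj.mul_right_inj
    · rw [eN_eq_stdAddChar, map_mul, Int.cast_natCast, ZMod.natCast_zmod_val]
      linear_combination χ s * ZMod.stdAddChar ((u : ZMod (p ^ k)) * s) * hnorm
  simp_rw [hsub]
  rw [sum_ite_castHom_eq_one hp.two_le hj (by omega : j ≤ k)]
  have hterm : ∀ x : ℕ, χ ((1 + p ^ j * x : ℤ) : ZMod (p ^ k)) *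
      ZMod.stdAddChar ((u : ZMod (p ^ k)) * ((1 + p ^ j * x : ℤ) : ZMod (p ^ k))) =
      eN (p ^ k) u * eN (p ^ (k - j)) ((ℓ + u) * x + -(b * ℓ) * p ^ j * x ^ 2) := by
    intro x
    have h1 : eN (p ^ k) (p ^ j * (u * x)) = eN (p ^ (k - j)) (u * x) := by
      rw [← eN_mul_left (pow_ne_zero j hp.ne_zero) (p ^ (k - j)), ← pow_add,
        Nat.add_sub_cancel' (by omega)]
      push_cast
      rfl
    rw [hpost, ← Int.cast_mul, ← eN_eq_stdAddChar,
      show u * (1 + p ^ j * x) = u + p ^ j * (u * x) by ring, eN_add, h1, mul_left_comm, ← eN_add]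
    congr 2
    ring
  simp_rw [hterm]
  have hiff : ℓ ≡ -u [ZMOD (p ^ j : ℕ)] ↔ (p ^ j : ℤ) ∣ ℓ + u := by
    rw [Int.modEq_comm, Int.modEq_iff_dvd, sub_neg_eq_add]
    push_cast
    rfl
  rw [← Finset.mul_sum, sum_eN_linear_add_quadratic hp hp2 hjk hℓ hb hc hj]
  simp only [hiff]
  split_ifs <;> ring

open Classical in
/-- Average of Gauss sums times character values along an even coset, quadratic range
(Lemma 2.8). -/
theorem gauss_sum_average_coset_quadratic (p j k : ℕ) (hp : p.Prime) (hp5 : 5 ≤ p)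
    (hk : 2 ≤ k) (hkj : k ≤ 3 * j) (hjk : 2 * j ≤ k)
    (χ : DirichletCharacter ℂ (p ^ k)) (hχ : χ.IsPrimitive) (hχeven : χ.Even)
    (ℓ b m c : ℤ) (hℓ : ¬ ((p : ℤ) ∣ ℓ)) (hm : Int.gcd m p = 1)
    (hb : 2 * b ≡ 1 [ZMOD (p ^ (k - j) : ℕ)])
    (hpost : ∀ x : ℤ, χ ((1 + p ^ j * x : ℤ) : ZMod (p ^ k)) =
      eN (p ^ (k - j)) (ℓ * (x - b * p ^ j * x ^ 2)))
    (hc : 2 * ℓ * c ≡ 1 [ZMOD (p ^ (k - 2 * j) : ℕ)]) :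
    haveI : NeZero (p ^ k) := ⟨pow_ne_zero _ hp.ne_zero⟩
    (∑ ψ : DirichletCharacter ℂ (p ^ j),
        if ψ.Even then
          (∑ t : ZMod (p ^ k),
            (χ * DirichletCharacter.changeLevel (pow_dvd_pow p (by omega : j ≤ k)) ψ) t *
              eN (p ^ k) (t.val : ℤ)) *
          (starRingEnd ℂ)
            ((χ * DirichletCharacter.changeLevel (pow_dvd_pow p (by omega : j ≤ k)) ψ)
              ((m : ℤ) : ZMod (p ^ k)))
        else 0)
      = (Real.sqrt (p ^ k) : ℂ) * ((p ^ j).totient : ℂ) *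
          ((1 / 2) * eN (p ^ k) m * (if ℓ ≡ -m [ZMOD (p ^ j : ℕ)] then 1 else 0) *
              (jacobiSym (-2 * ℓ) (p ^ k) : ℂ) * epsFactor (p ^ k) *
              eN (p ^ (k - 2 * j)) (c * ((ℓ + m) / (p ^ j : ℤ)) ^ 2)
            + (1 / 2) * eN (p ^ k) (-m) * (if ℓ ≡ m [ZMOD (p ^ j : ℕ)] then 1 else 0) *
              (jacobiSym (-2 * ℓ) (p ^ k) : ℂ) * epsFactor (p ^ k) *
              eN (p ^ (k - 2 * j)) (c * ((ℓ - m) / (p ^ j : ℤ)) ^ 2)) := by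
  have : NeZero (p ^ k) := ⟨pow_ne_zero _ hp.ne_zero⟩
  have : NeZero (p ^ j) := ⟨pow_ne_zero _ hp.ne_zero⟩
  have hj : j ≠ 0 := by omega
  have hle : j ≤ k := by omega
  have hp2 : p ≠ 2 := by omega
  have hcop : IsCoprime m (p : ℤ) := Int.isCoprime_iff_gcd_eq_one.mpr hm
  have hmj : IsUnit ((m : ℤ) : ZMod (p ^ j)) := by
    rw [ZMod.coe_int_isUnit_iff_isCoprime]
    push_cast
    exact hcop.symm.pow_left
  have hneg : χ ((-m : ℤ) : ZMod (p ^ k)) = χ ((m : ℤ) : ZMod (p ^ k)) := by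
    push_cast
    exact DirichletCharacter.Even.eval_neg χ _ hχeven
  have hterm : ∀ ψ : DirichletCharacter ℂ (p ^ j),
      (if ψ.Even then
          (∑ t : ZMod (p ^ k),
            (χ * DirichletCharacter.changeLevel (pow_dvd_pow p hle) ψ) t *
              eN (p ^ k) (t.val : ℤ)) *
          (starRingEnd ℂ)
            ((χ * DirichletCharacter.changeLevel (pow_dvd_pow p hle) ψ)
              ((m : ℤ) : ZMod (p ^ k)))
        else 0) =
      ∑ t : ZMod (p ^ k), χ t * eN (p ^ k) (t.val : ℤ) * (starRingEnd ℂ) (χ (m : ZMod (p ^ k))) *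
        if ψ.Even then ψ (ZMod.castHom (pow_dvd_pow p hle) (ZMod (p ^ j)) t) *
          (starRingEnd ℂ) (ψ (m : ZMod (p ^ j))) else 0 := by
    intro ψ
    split_ifs
    · rw [Finset.sum_mul]
      refine Finset.sum_congr rfl fun t _ ↦ ?_
      rw [MulChar.mul_apply, MulChar.mul_apply, changeLevel_pow_apply hj hle,
        changeLevel_pow_apply hj hle,
        map_intCast (ZMod.castHom (pow_dvd_pow p hle) (ZMod (p ^ j))), map_mul (starRingEnd ℂ)]
      ring
    · simp
  have hsum : ∀ t : ZMod (p ^ k),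
      ∑ ψ : DirichletCharacter ℂ (p ^ j),
        (χ t * eN (p ^ k) (t.val : ℤ) * (starRingEnd ℂ) (χ (m : ZMod (p ^ k))) *
          if ψ.Even then ψ (ZMod.castHom (pow_dvd_pow p hle) (ZMod (p ^ j)) t) *
            (starRingEnd ℂ) (ψ (m : ZMod (p ^ j))) else 0) =
      ((p ^ j).totient : ℂ) / 2 *
        ((if ZMod.castHom (pow_dvd_pow p hle) (ZMod (p ^ j)) t = ((m : ℤ) : ZMod (p ^ j)) then
          χ t * eN (p ^ k) (t.val : ℤ) * (starRingEnd ℂ) (χ ((m : ℤ) : ZMod (p ^ k))) else 0) +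
        (if ZMod.castHom (pow_dvd_pow p hle) (ZMod (p ^ j)) t = ((-m : ℤ) : ZMod (p ^ j)) then
          χ t * eN (p ^ k) (t.val : ℤ) * (starRingEnd ℂ) (χ ((-m : ℤ) : ZMod (p ^ k))) else 0)) := by
    intro t
    rw [← Finset.mul_sum, sum_even_char_mul_conj hmj, hneg, Int.cast_neg]
    split_ifs <;> ring
  rw [Finset.sum_congr rfl fun ψ _ ↦ hterm ψ, Finset.sum_comm, Finset.sum_congr rfl fun t _ ↦ hsum t,
    ← Finset.mul_sum, Finset.sum_add_distrib,
    sum_ite_castHom_eq_mul_conj hp hp2 hjk hj χ hℓ hb hpost hc hcop,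
    sum_ite_castHom_eq_mul_conj hp hp2 hjk hj χ hℓ hb hpost hc hcop.neg_left,
    neg_neg, ← sub_eq_add_neg]
  ring
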